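/- (Corollary 4.5) Let λ = (σ₂/2 - ρσ₁)√T, μ = -σ₂√T/2, γ = σ₂√T/2. Then b₁(λ) = b₂(μ) = b₃(γ) = F₂/(F₂+K) and a₁(λ) = a₂(μ) = a₃(γ) = F₂ + K, and with b = F₂/(F₂+K), a = F₂+K, κ = bσ₂/σ₁, σ = √(σ₁² + b²σ₂² - 2ρbσ₁σ₂), the three quantities -[z₀¹(σ₂b₁(λ), a₁(λ), λ) - κλ]/√(1+κ²-2ρκ), -[z₀²(σ₂b₂(μ), a₂(μ), μ) - κμ]/√(1+κ²-2ρκ), -[z₀³(σ₂b₃(γ), a₃(γ), γ) - κγ]/√(1+κ²-2ρκ) equal respectively d̄₁ = ( ln(F₁/a) + (σ₁²/2 + b²σ₂²/2 - bρσ₁σ₂)T )/(σ√T), d̄₂ = ( ln(F₁/a) + (-σ₁²/2 - bσ₂² + b²σ₂²/2 + ρσ₁σ₂)T )/(σ√T), d̄₃ = ( ln(F₁/a) + (-σ₁²/2 + b²σ₂²/2)T )/(σ√T); hence the generalized formula Π_T(λ,μ,γ) coincides with the Bjerksund–Stensland price e^{-rT}[F₁Φ(d̄₁) - F₂Φ(d̄₂)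 - KΦ(d̄₃)]. -/

import Mathlib

open Real

/-- The standard normal cumulative distribution function Φ. -/
noncomputable def stdGaussianCDF (x : ℝ) : ℝ :=
  ((ProbabilityTheory.gaussianReal 0 1) (Set.Iic x)).toReal

/-- The volatility normalisation: `√(1 + κ² - 2ρκ) = σ / σ₁` for `κ = c / σ₁`. -/
lemma sqrt_one_add_sq_sub_eq_div {ρ c s : ℝ} (hs : 0 < s) :
    √(1 + (c / s) ^ 2 - 2 * ρ * (c / s)) = √(s ^ 2 + c ^ 2 - 2 * ρ * c * s) / s := by
  have h : 1 + (c / s) ^ 2 - 2 * ρ * (c / s) = (s ^ 2 + c ^ 2 - 2 * ρ * c * s) / s ^ 2 := by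
    field_simp
  rw [h, Real.sqrt_div' _ (sq_nonneg s), Real.sqrt_sq hs.le]

lemma neg_div_div_eq_div_mul {x n s t v : ℝ} (ht : t ≠ 0) (h : x * (s * t) = -n) :
    -x / (v / s) = n / (v * t) := by
  rw [div_div_eq_mul_div, ← mul_div_mul_right _ _ ht]
  congr 1
  linarith

lemma log_mul_exp_div {a F : ℝ} (ha : 0 < a) (hF : 0 < F) (x : ℝ) :
    Real.log (a * Real.exp x / F) = x - Real.log (F / a) := by
  rw [Real.log_div (by positivity) hF.ne', Real.log_mul ha.ne' (Real.exp_ne_zero x),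
    Real.log_exp, Real.log_div hF.ne' ha.ne']
  ring

/-- (Corollary 4.5) With `λ = (σ₂/2 - ρσ₁)√T`, `μ = -σ₂√T/2`, `γ = σ₂√T/2`, one has
`b₁(λ) = b₂(μ) = b₃(γ) = F₂/(F₂+K)` and `a₁(λ) = a₂(μ) = a₃(γ) = F₂+K`, the three
quantities `-[z₀ⁱ(σ₂bᵢ, aᵢ, ·) - κ·]/√(1+κ²-2ρκ)` equal `d̄₁, d̄₂, d̄₃` respectively,
and the generalized formula `Π_T(λ,μ,γ)` coincides with the Bjerksund–Stensland price. -/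
theorem generalized_formula_reduces_to_BS
    (ρ T σ₁ σ₂ F₁ F₂ K r : ℝ)
    (hρ₁ : -1 < ρ) (hρ₂ : ρ < 1) (hT : 0 < T)
    (hσ₁ : 0 < σ₁) (hσ₂ : 0 < σ₂) (hF₁ : 0 < F₁) (hF₂ : 0 < F₂) (hK : 0 < K)
    (α g₂ Fb₂ : ℝ)
    (hα : α = Real.exp (ρ * σ₁ * σ₂ * T))
    (hg₂ : g₂ = Real.exp (σ₂ ^ 2 * T))
    (hFb₂ : Fb₂ = F₂ * Real.exp (-(σ₂ ^ 2 * T) / 2))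
    (b₁ b₂ b₃ a₁ a₂ a₃ : ℝ → ℝ)
    (hb₁ : b₁ = fun x => α * Fb₂ * Real.exp (σ₂ * Real.sqrt T * x)
      / (α * Fb₂ * Real.exp (σ₂ * Real.sqrt T * x) + K))
    (hb₂ : b₂ = fun x => g₂ * Fb₂ * Real.exp (σ₂ * Real.sqrt T * x)
      / (g₂ * Fb₂ * Real.exp (σ₂ * Real.sqrt T * x) + K))
    (hb₃ : b₃ = fun x => Fb₂ * Real.exp (σ₂ * Real.sqrt T * x)
      / (Fb₂ * Real.exp (σ₂ * Real.sqrt T * x) + K))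
    (ha₁ : a₁ = fun x => F₂ + K * Real.exp (-(σ₂ * Real.sqrt T * x) - ρ * σ₁ * σ₂ * T + σ₂ ^ 2 * T / 2))
    (ha₂ : a₂ = fun x => F₂ + K * Real.exp (-(σ₂ * Real.sqrt T * x) - σ₂ ^ 2 * T / 2))
    (ha₃ : a₃ = fun x => F₂ + K * Real.exp (-(σ₂ * Real.sqrt T * x) + σ₂ ^ 2 * T / 2))
    (z₁ z₂ z₃ : ℝ → ℝ → ℝ → ℝ)
    (hz₁ : z₁ = fun q a h => (1 / (σ₁ * Real.sqrt T)) *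
      Real.log (a * Real.exp (ρ * σ₁ * q * T + q * Real.sqrt T * h - q ^ 2 * T / 2) / F₁)
      - σ₁ * Real.sqrt T / 2)
    (hz₂ : z₂ = fun q a h => (1 / (σ₁ * Real.sqrt T)) *
      Real.log (a * Real.exp (q * σ₂ * T + q * Real.sqrt T * h - q ^ 2 * T / 2) / F₁)
      + (σ₁ / 2 - ρ * σ₂) * Real.sqrt T)
    (hz₃ : z₃ = fun q a h => (1 / (σ₁ * Real.sqrt T)) *
      Real.log (a * Real.exp (q * Real.sqrt T * h - q ^ 2 * T / 2) / F₁)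
      + σ₁ * Real.sqrt T / 2)
    (lam μ γ : ℝ)
    (hlam : lam = (σ₂ / 2 - ρ * σ₁) * Real.sqrt T)
    (hμ : μ = -(σ₂ * Real.sqrt T) / 2)
    (hγ : γ = σ₂ * Real.sqrt T / 2)
    (b a κ σ : ℝ)
    (hb : b = F₂ / (F₂ + K)) (ha : a = F₂ + K)
    (hκ : κ = b * σ₂ / σ₁)
    (hσ : σ = Real.sqrt (σ₁ ^ 2 + b ^ 2 * σ₂ ^ 2 - 2 * ρ * b * σ₁ * σ₂))
    (d₁ d₂ d₃ : ℝ)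
    (hd₁ : d₁ = (Real.log (F₁ / a)
      + (σ₁ ^ 2 / 2 + b ^ 2 * σ₂ ^ 2 / 2 - b * ρ * σ₁ * σ₂) * T) / (σ * Real.sqrt T))
    (hd₂ : d₂ = (Real.log (F₁ / a)
      + (-σ₁ ^ 2 / 2 - b * σ₂ ^ 2 + b ^ 2 * σ₂ ^ 2 / 2 + ρ * σ₁ * σ₂) * T) / (σ * Real.sqrt T))
    (hd₃ : d₃ = (Real.log (F₁ / a)
      + (-σ₁ ^ 2 / 2 + b ^ 2 * σ₂ ^ 2 / 2) * T) / (σ * Real.sqrt T)) :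
    b₁ lam = F₂ / (F₂ + K) ∧ b₂ μ = F₂ / (F₂ + K) ∧ b₃ γ = F₂ / (F₂ + K) ∧
    a₁ lam = F₂ + K ∧ a₂ μ = F₂ + K ∧ a₃ γ = F₂ + K ∧
    -(z₁ (σ₂ * b₁ lam) (a₁ lam) lam - κ * lam) / Real.sqrt (1 + κ ^ 2 - 2 * ρ * κ) = d₁ ∧
    -(z₂ (σ₂ * b₂ μ) (a₂ μ) μ - κ * μ) / Real.sqrt (1 + κ ^ 2 - 2 * ρ * κ) = d₂ ∧
    -(z₃ (σ₂ * b₃ γ) (a₃ γ) γ - κ * γ) / Real.sqrt (1 + κ ^ 2 - 2 * ρ * κ) = d₃ ∧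
    Real.exp (-(r * T)) *
      (F₁ * stdGaussianCDF
          (-(z₁ (σ₂ * b₁ lam) (a₁ lam) lam - κ * lam) / Real.sqrt (1 + κ ^ 2 - 2 * ρ * κ))
      - F₂ * stdGaussianCDF
          (-(z₂ (σ₂ * b₂ μ) (a₂ μ) μ - κ * μ) / Real.sqrt (1 + κ ^ 2 - 2 * ρ * κ))
      - K * stdGaussianCDF
          (-(z₃ (σ₂ * b₃ γ) (a₃ γ) γ - κ * γ) / Real.sqrt (1 + κ ^ 2 - 2 * ρ * κ)))
    = Real.exp (-(r * T)) *
      (F₁ * stdGaussianCDF d₁ - F₂ * stdGaussianCDF d₂ - K * stdGaussianCDF d₃) := by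
  have hsT : √T ≠ 0 := (Real.sqrt_pos.2 hT).ne'
  have hT2 : √T * √T = T := Real.mul_self_sqrt hT.le
  have hapos : 0 < a := by rw [ha]; positivity
  have hnorm : √(1 + κ ^ 2 - 2 * ρ * κ) = σ / σ₁ := by
    rw [hκ, sqrt_one_add_sq_sub_eq_div hσ₁, hσ]
    ring_nf
  have hlam' : σ₂ * √T * lam = (σ₂ ^ 2 / 2 - ρ * σ₁ * σ₂) * T := by
    rw [hlam]; linear_combination σ₂ * (σ₂ / 2 - ρ * σ₁) * hT2
  have hμ' : σ₂ * √T * μ = -(σ₂ ^ 2 * T) / 2 := by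
    rw [hμ]; linear_combination -σ₂ ^ 2 / 2 * hT2
  have hγ' : σ₂ * √T * γ = σ₂ ^ 2 * T / 2 := by
    rw [hγ]; linear_combination σ₂ ^ 2 / 2 * hT2
  have hb₁' : b₁ lam = b := by
    have h : α * Fb₂ * Real.exp (σ₂ * √T * lam) = F₂ := by
      rw [hα, hFb₂, hlam', mul_left_comm, mul_assoc, ← Real.exp_add, ← Real.exp_add]
      ring_nf
      simp
    simp only [hb₁, h, hb]
  have hb₂' : b₂ μ = b := by
    have h : g₂ * Fb₂ * Real.exp (σ₂ * √T * μ) = F₂ := by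
      rw [hg₂, hFb₂, hμ', mul_left_comm, mul_assoc, ← Real.exp_add, ← Real.exp_add]
      ring_nf
      simp
    simp only [hb₂, h, hb]
  have hb₃' : b₃ γ = b := by
    have h : Fb₂ * Real.exp (σ₂ * √T * γ) = F₂ := by
      rw [hFb₂, hγ', mul_assoc, ← Real.exp_add]
      ring_nf
      simp
    simp only [hb₃, h, hb]
  have ha₁' : a₁ lam = a := by
    simp only [ha₁, hlam', ha]
    ring_nf
    simp
  have ha₂' : a₂ μ = a := by
    simp only [ha₂, hμ', ha]
    ring_nf
    simp
  have ha₃' : a₃ γ = a := by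
    simp only [ha₃, hγ', ha]
    ring_nf
    simp
  have hd₁' : -(z₁ (σ₂ * b₁ lam) (a₁ lam) lam - κ * lam) /
      √(1 + κ ^ 2 - 2 * ρ * κ) = d₁ := by
    rw [hnorm, hb₁', ha₁', hd₁]
    apply neg_div_div_eq_div_mul hsT
    simp only [hz₁, log_mul_exp_div hapos hF₁, hκ]
    field_simp
    linear_combination -σ₁ ^ 2 * hT2
  have hd₂' : -(z₂ (σ₂ * b₂ μ) (a₂ μ) μ - κ * μ) /
      √(1 + κ ^ 2 - 2 * ρ * κ) = d₂ := by
    rw [hnorm, hb₂', ha₂', hd₂]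
    apply neg_div_div_eq_div_mul hsT
    simp only [hz₂, log_mul_exp_div hapos hF₁, hκ]
    field_simp
    linear_combination σ₁ * (σ₁ - 2 * ρ * σ₂) * hT2
  have hd₃' : -(z₃ (σ₂ * b₃ γ) (a₃ γ) γ - κ * γ) /
      √(1 + κ ^ 2 - 2 * ρ * κ) = d₃ := by
    rw [hnorm, hb₃', ha₃', hd₃]
    apply neg_div_div_eq_div_mul hsT
    simp only [hz₃, log_mul_exp_div hapos hF₁, hκ]
    field_simp
    linear_combination σ₁ ^ 2 * hT2
  rw [hd₁', hd₂', hd₃', ← hb, ← ha]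
  exact ⟨hb₁', hb₂', hb₃', ha₁', ha₂', ha₃', rfl, rfl, rfl, rfl⟩
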